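/- Let φ be a formula with subformula set Ξ, (−)♭ the fixed flattening injection, and N the associated clause set over all basic sentences. For any set of clauses C and any subformula χ₁ ∨ χ₂ ∈ Ξ: C ∪ N ⊢ (χ₁ ∨ χ₂)♭ if and only if for every basic sentence x, C ∪ N ⊢ ((χ₁♭ → x) ∧ (χ₂♭ → x)) → x. -/

import Mathlib

/-- Formulas of intuitionistic propositional logic over a countably infinite
set of atomic propositions (basic sentences), identified with `ℕ`. -/
inductive Formula : Type where
  | atom : ℕ → Formula
  | bot  : Formula
  | and  : Formula → Formula → Formula
  | or   : Formula → Formula → Formula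
  | imp  : Formula → Formula → Formula
deriving DecidableEq

/-- Derivability in intuitionistic propositional natural deduction (NJ)
from a set of hypotheses. -/
inductive NJ : Set Formula → Formula → Prop where
  | hyp   {Γ : Set Formula} {φ : Formula}     : φ ∈ Γ → NJ Γ φ
  | andI  {Γ : Set Formula} {φ ψ : Formula}   : NJ Γ φ → NJ Γ ψ → NJ Γ (φ.and ψ)
  | andE1 {Γ : Set Formula} {φ ψ : Formula}   : NJ Γ (φ.and ψ) → NJ Γ φ
  | andE2 {Γ : Set Formula} {φ ψ : Formula}   : NJ Γ (φ.and ψ) → NJ Γ ψ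
  | orI1  {Γ : Set Formula} {φ ψ : Formula}   : NJ Γ φ → NJ Γ (φ.or ψ)
  | orI2  {Γ : Set Formula} {φ ψ : Formula}   : NJ Γ ψ → NJ Γ (φ.or ψ)
  | orE   {Γ : Set Formula} {φ ψ χ : Formula} : NJ Γ (φ.or ψ) → NJ (insert φ Γ) χ → NJ (insert ψ Γ) χ → NJ Γ χ
  | impI  {Γ : Set Formula} {φ ψ : Formula}   : NJ (insert φ Γ) ψ → NJ Γ (φ.imp ψ)
  | impE  {Γ : Set Formula} {φ ψ : Formula}   : NJ Γ (φ.imp ψ) → NJ Γ φ → NJ Γ ψ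
  | botE  {Γ : Set Formula} {φ : Formula}     : NJ Γ Formula.bot → NJ Γ φ

/-- An atomic rule: either a nullary rule `ε ⇒ c`, or a general rule
`(P₁ ⇒ p₁),…,(Pₙ ⇒ pₙ) ⇒ c` with `n ≥ 1` (encoded as head premise plus
a list of further premises), where each premise is a pair of a finite set
of basic sentences and a basic sentence. -/
inductive AtomicRule : Type where
  | nullary : ℕ → AtomicRule
  | general : (Finset ℕ × ℕ) → List (Finset ℕ × ℕ) → ℕ → AtomicRule

/-- A base is a set of atomic rules. -/
abbrev Base := Set AtomicRule

/-- Derivability in a base `B`: the smallest relation `P ⊢_B p` closed under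
the three clauses. -/
inductive BaseDer (B : Base) : Set ℕ → ℕ → Prop where
  | hyp {P : Set ℕ} {p : ℕ} : p ∈ P → BaseDer B P p
  | nullary {P : Set ℕ} {c : ℕ} : AtomicRule.nullary c ∈ B → BaseDer B P c
  | general {P : Set ℕ} {hd : Finset ℕ × ℕ} {tl : List (Finset ℕ × ℕ)} {c : ℕ} :
      AtomicRule.general hd tl c ∈ B →
      (∀ pr ∈ hd :: tl, BaseDer B (P ∪ ↑pr.1) pr.2) →
      BaseDer B P c

/-- Sandqvist's support relation `⊩_B φ`, defined by recursion on the
structure of `φ` (equivalently, on logical weight). -/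
def Supp : Base → Formula → Prop
  | B, .atom p  => BaseDer B ∅ p
  | B, .bot     => ∀ p : ℕ, BaseDer B ∅ p
  | B, .and φ ψ => Supp B φ ∧ Supp B ψ
  | B, .or φ ψ  => ∀ C : Base, B ⊆ C → ∀ p : ℕ,
      (∀ D : Base, C ⊆ D → Supp D φ → BaseDer D ∅ p) →
      (∀ D : Base, C ⊆ D → Supp D ψ → BaseDer D ∅ p) →
      BaseDer C ∅ p
  | B, .imp φ ψ => ∀ C : Base, B ⊆ C → Supp C φ → Supp C ψ

/-- Support relative to a context: `Γ ⊩_B φ`. -/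
def SuppCtx (Γ : Set Formula) (B : Base) (φ : Formula) : Prop :=
  ∀ C : Base, B ⊆ C → (∀ ψ ∈ Γ, Supp C ψ) → Supp C φ

/-- `f` is a (possibly iterated) conjunction `p₁ ∧ … ∧ pₙ` (n ≥ 1) of atoms. -/
inductive AtomsConj : Formula → Prop where
  | atom (p : ℕ) : AtomsConj (.atom p)
  | and {a b : Formula} : AtomsConj a → AtomsConj b → AtomsConj (a.and b)

/-- `q*` : either a basic sentence or `⊥`. -/
def AtomOrBot (f : Formula) : Prop := (∃ p : ℕ, f = .atom p) ∨ f = .bot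

/-- An intuitionistic clause in the sense of Mints: a formula of one of the
forms `(p → q*) → r`, `p → (q ∨ r)`, or `(p₁ ∧ … ∧ pₙ) → q*`. -/
inductive IsClause : Formula → Prop where
  | impImp (p r : ℕ) {q : Formula} : AtomOrBot q →
      IsClause (((Formula.atom p).imp q).imp (.atom r))
  | impOr (p q r : ℕ) :
      IsClause ((Formula.atom p).imp ((Formula.atom q).or (.atom r)))
  | conjImp {a q : Formula} : AtomsConj a → AtomOrBot q →
      IsClause (a.imp q)

/-- A clausal system: a set of intuitionistic clauses. -/
def ClausalSystem (C : Set Formula) : Prop := ∀ f ∈ C, IsClause f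

/-- The set of subformulas of a formula. -/
def subf : Formula → Finset Formula
  | .atom p  => {.atom p}
  | .bot     => {.bot}
  | .and a b => insert (a.and b) (subf a ∪ subf b)
  | .or a b  => insert (a.or b) (subf a ∪ subf b)
  | .imp a b => insert (a.imp b) (subf a ∪ subf b)

/-- `⊥` occurs in `φ` only as the conclusion of an implication. -/
def BotGuarded : Formula → Prop
  | .atom _  => True
  | .bot     => False
  | .and a b => BotGuarded a ∧ BotGuarded b
  | .or a b  => BotGuarded a ∧ BotGuarded b
  | .imp a b => BotGuarded a ∧ (b = .bot ∨ BotGuarded b)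

/-- `fl` is a flattening for `φ`: an injection from `Ξ ∪ {⊥}` (where `Ξ` is
the set of subformulas of `φ`) into the basic sentences which fixes the
atoms of `Ξ`. -/
def FlatFor (fl : Formula → ℕ) (φ : Formula) : Prop :=
  (∀ a ∈ insert Formula.bot (subf φ), ∀ b ∈ insert Formula.bot (subf φ),
      fl a = fl b → a = b) ∧
  (∀ p : ℕ, Formula.atom p ∈ subf φ → fl (.atom p) = p)

/-- The clauses `M_X(χ)` associated with a complex subformula `χ`, relative
to a set `X` of basic sentences. -/
def MX (fl : Formula → ℕ) (X : Set ℕ) : Formula → Set Formula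
  | .and a b =>
      { (Formula.atom (fl (a.and b))).imp (.atom (fl a)),
        (Formula.atom (fl (a.and b))).imp (.atom (fl b)),
        ((Formula.atom (fl a)).and (.atom (fl b))).imp (.atom (fl (a.and b))) }
  | .or a b =>
      { (Formula.atom (fl a)).imp (.atom (fl (a.or b))),
        (Formula.atom (fl b)).imp (.atom (fl (a.or b))) } ∪
      { f | ∃ x ∈ X, f =
          (((Formula.atom (fl (a.or b))).and
              ((Formula.atom (fl a)).imp (.atom x))).and
            ((Formula.atom (fl b)).imp (.atom x))).imp (.atom x) }
  | .imp a b =>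
      { ((Formula.atom (fl a)).imp (.atom (fl b))).imp (.atom (fl (a.imp b))),
        ((Formula.atom (fl (a.imp b))).and (.atom (fl a))).imp (.atom (fl b)) }
  | _ => ∅

/-- The clause set `N := ⋃_{χ ∈ Ξ} M_𝔹(χ) ∪ {⊥♭ → x : x ∈ 𝔹}`, relative to
all basic sentences. -/
def Nset (fl : Formula → ℕ) (φ : Formula) : Set Formula :=
  (⋃ χ ∈ (↑(subf φ) : Set Formula), MX fl Set.univ χ) ∪
  { f | ∃ x : ℕ, f = (Formula.atom (fl .bot)).imp (.atom x) }

/-- Right-nested conjunction of a nonempty list of atoms (`⊥` for the empty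
list, which never occurs below). -/
def conjAtoms : List ℕ → Formula
  | []            => .bot
  | [p]           => .atom p
  | p :: q :: rest => (Formula.atom p).and (conjAtoms (q :: rest))

/-- Canonical conjunction `⋀X` of a finite set of atoms. -/
def bigConj (X : Finset ℕ) : Formula := conjAtoms (X.sort (· ≤ ·))

/-- The atoms occurring in a formula. -/
def atomsOf : Formula → Finset ℕ
  | .atom p  => {p}
  | .bot     => ∅
  | .and a b => atomsOf a ∪ atomsOf b
  | .or a b  => atomsOf a ∪ atomsOf b
  | .imp a b => atomsOf a ∪ atomsOf b

/-- `X`, the range of the flattening `fl` on `Ξ ∪ {⊥}`. -/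
def flatRange (fl : Formula → ℕ) (φ : Formula) : Finset ℕ :=
  (insert Formula.bot (subf φ)).image fl

/-- Mints' full clause set
`M_X := ⋃_{χ ∈ Ξ} M_X(χ) ∪ {(⋀X ∧ y) → ⊥♭} ∪ {⊥♭ → y} ∪ {⊥♭ → x : x ∈ X}`,
where `y` is a fresh basic sentence. -/
def MXfull (fl : Formula → ℕ) (φ : Formula) (y : ℕ) : Set Formula :=
  (⋃ χ ∈ (↑(subf φ) : Set Formula), MX fl ↑(flatRange fl φ) χ) ∪
  { ((bigConj (flatRange fl φ)).and (.atom y)).imp (.atom (fl .bot)),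
    (Formula.atom (fl .bot)).imp (.atom y) } ∪
  { f | ∃ x ∈ flatRange fl φ, f = (Formula.atom (fl .bot)).imp (.atom x) }

/-- `φ[q/⊥]`: replace every occurrence of `⊥` by the atom `q`. -/
def substBot (q : ℕ) : Formula → Formula
  | .atom p  => .atom p
  | .bot     => .atom q
  | .and a b => (substBot q a).and (substBot q b)
  | .or a b  => (substBot q a).or (substBot q b)
  | .imp a b => (substBot q a).imp (substBot q b)

/-- Right-nested conjunction of a nonempty list of formulas. -/
def conjFmls : Formula → List Formula → Formula
  | f, []        => f
  | f, g :: rest => f.and (conjFmls g rest)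

/-- The formula `⋀P → p` associated with a premise `(P ⇒ p)`, with
`⋀∅ → p` read as `p`. -/
def premFml (pr : Finset ℕ × ℕ) : Formula :=
  if pr.1 = ∅ then .atom pr.2
  else (conjAtoms (pr.1.sort (· ≤ ·))).imp (.atom pr.2)

/-- The translation `[−]` from atomic rules to formulas:
`[ε ⇒ c] = c` and
`[(P₁ ⇒ p₁),…,(Pₙ ⇒ pₙ) ⇒ c] = ((⋀P₁ → p₁) ∧ … ∧ (⋀Pₙ → pₙ)) → c`. -/
def ruleTr : AtomicRule → Formula
  | .nullary c       => .atom c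
  | .general hd tl c => (conjFmls (premFml hd) (tl.map premFml)).imp (.atom c)

/-- The translation of a base: `[𝓑] := {[r] : r ∈ 𝓑}`. -/
def baseTr (B : Base) : Set Formula := ruleTr '' B

theorem NJ.weaken {Γ Δ : Set Formula} {φ : Formula} (h : NJ Γ φ) (hΓ : Γ ⊆ Δ) : NJ Δ φ := by
  induction h generalizing Δ with
  | hyp h => exact .hyp (hΓ h)
  | andI _ _ ih₁ ih₂ => exact .andI (ih₁ hΓ) (ih₂ hΓ)
  | andE1 _ ih => exact .andE1 (ih hΓ)
  | andE2 _ ih => exact .andE2 (ih hΓ)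
  | orI1 _ ih => exact .orI1 (ih hΓ)
  | orI2 _ ih => exact .orI2 (ih hΓ)
  | orE _ _ _ ih ih₁ ih₂ =>
    exact .orE (ih hΓ) (ih₁ (Set.insert_subset_insert hΓ)) (ih₂ (Set.insert_subset_insert hΓ))
  | impI _ ih => exact .impI (ih (Set.insert_subset_insert hΓ))
  | impE _ _ ih₁ ih₂ => exact .impE (ih₁ hΓ) (ih₂ hΓ)
  | botE _ ih => exact .botE (ih hΓ)

theorem MX_subset_Nset {fl : Formula → ℕ} {φ χ : Formula} (hχ : χ ∈ subf φ) :
    MX fl Set.univ χ ⊆ Nset fl φ :=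
  fun _ hf => Or.inl (Set.mem_biUnion (Finset.mem_coe.2 hχ) hf)

/-- Reduction for disjunction: `C ∪ N ⊢ (χ₁ ∨ χ₂)♭` iff for every basic
sentence `x`, `C ∪ N ⊢ ((χ₁♭ → x) ∧ (χ₂♭ → x)) → x`. -/
theorem reduction_or (φ : Formula) (hφ : BotGuarded φ)
    (fl : Formula → ℕ) (hfl : FlatFor fl φ)
    (C : Set Formula) (hC : ClausalSystem C)
    (χ₁ χ₂ : Formula) (hχ : χ₁.or χ₂ ∈ subf φ) :
    NJ (C ∪ Nset fl φ) (.atom (fl (χ₁.or χ₂))) ↔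
      ∀ x : ℕ, NJ (C ∪ Nset fl φ)
        ((((Formula.atom (fl χ₁)).imp (.atom x)).and
          ((Formula.atom (fl χ₂)).imp (.atom x))).imp (.atom x)) := by
  have clause {f : Formula} (hf : f ∈ MX fl Set.univ (χ₁.or χ₂)) : NJ (C ∪ Nset fl φ) f :=
    .hyp (Or.inr (MX_subset_Nset hχ hf))
  constructor
  · intro h x
    have elim := clause (Or.inr ⟨x, Set.mem_univ x, rfl⟩)
    have cases := NJ.hyp (Set.mem_insert (((Formula.atom (fl χ₁)).imp (.atom x)).and
      ((Formula.atom (fl χ₂)).imp (.atom x))) (C ∪ Nset fl φ))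
    exact .impI (.impE (elim.weaken (Set.subset_insert _ _))
      (.andI (.andI (h.weaken (Set.subset_insert _ _)) cases.andE1) cases.andE2))
  · intro h
    exact .impE (h (fl (χ₁.or χ₂)))
      (.andI (clause (Or.inl (Or.inl rfl))) (clause (Or.inl (Or.inr rfl))))
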